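/- Let I be a Cohen-Macaulay R-ideal of positive grade and let (S,J) be a deformation of (R,I), where S is a local Gorenstein ring with infinite residue field. Then ∫_R I ⊆ (∫_S J)R, where (∫_S J)R denotes the image of ∫_S J under the surjection S → S/(x) ≅ R. -/

import Mathlib

open RingTheory IsLocalRing

/-- A proper ideal generated by a regular sequence is a complete intersection. -/
def IsCompleteIntersectionIdeal (R : Type) [CommRing R] (I : Ideal R) : Prop :=
  I ≠ ⊤ ∧ ∃ rs : List R, RingTheory.Sequence.IsRegular R rs ∧ Ideal.ofList rs = I

/-- Two proper ideals are directly linked if there is a complete intersection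
`c ⊆ I ⊓ J` with `I = c : J` and `J = c : I`. -/
def IsDirectlyLinked (R : Type) [CommRing R] (I J : Ideal R) : Prop :=
  I ≠ ⊤ ∧ J ≠ ⊤ ∧ ∃ c : Ideal R, IsCompleteIntersectionIdeal R c ∧ c ≤ I ⊓ J ∧
    Submodule.colon c J = I ∧ Submodule.colon c I = J

/-- The linkage (liaison) equivalence: the equivalence relation generated by direct linkage. -/
def InSameLinkageClass (R : Type) [CommRing R] (I J : Ideal R) : Prop :=
  Relation.EqvGen (IsDirectlyLinked R) I J

/-- An ideal is licci if its linkage class contains a complete intersection. -/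
def Licci (R : Type) [CommRing R] (I : Ideal R) : Prop :=
  ∃ J, InSameLinkageClass R I J ∧ IsCompleteIntersectionIdeal R J

open Classical in
/-- `∫ I` : the sum of all ideals in the linkage class of `I` if `I` is not licci,
and the unit ideal otherwise. -/
noncomputable def intLink (R : Type) [CommRing R] (I : Ideal R) : Ideal R :=
  if Licci R I then ⊤ else sSup {J : Ideal R | InSameLinkageClass R I J}

/-- An ideal is maximal in its linkage class if it contains every ideal in its linkage class. -/
def MaximalInLinkageClass (R : Type) [CommRing R] (I : Ideal R) : Prop :=
  ∀ J, InSameLinkageClass R I J → J ≤ I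

/-- Linked in `n` steps. -/
def LinkedInSteps (R : Type) [CommRing R] : ℕ → Ideal R → Ideal R → Prop
  | 0, I, J => I = J
  | (n+1), I, J => ∃ K, IsDirectlyLinked R I K ∧ LinkedInSteps R n K J

/-- The grade of an ideal: the supremum of lengths of regular sequences contained in it. -/
noncomputable def gradeOf (R : Type) [CommRing R] (I : Ideal R) : ℕ :=
  sSup {n : ℕ | ∃ rs : List R, rs.length = n ∧ (∀ r ∈ rs, r ∈ I) ∧
    RingTheory.Sequence.IsRegular R rs}

/-- A Noetherian local ring is Cohen-Macaulay if its depth (the grade of its maximal ideal)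
equals its Krull dimension. -/
def IsCMLocalRing (A : Type) [CommRing A] [IsLocalRing A] : Prop :=
  ringKrullDim A = (gradeOf A (maximalIdeal A) : WithBot (WithTop ℕ))

/-- An ideal `I` of `R` is a Cohen-Macaulay ideal if `R/I` is a Cohen-Macaulay local ring. -/
def IsCMIdeal (R : Type) [CommRing R] (I : Ideal R) : Prop :=
  ∃ h : IsLocalRing (R ⧸ I), @IsCMLocalRing (R ⧸ I) _ h

/-- A Noetherian local ring is Gorenstein if it is Cohen-Macaulay and some ideal generated
by a regular sequence and primary to the maximal ideal is irreducible. -/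
def IsGorensteinLocalRing (A : Type) [CommRing A] [IsLocalRing A] : Prop :=
  IsCMLocalRing A ∧ ∃ rs : List A, RingTheory.Sequence.IsRegular A rs ∧
    (Ideal.ofList rs).radical = maximalIdeal A ∧ InfIrred (Ideal.ofList rs)

section IdealSequences

variable {A : Type*} [CommRing A]

/-- Multiplication by `x` is injective on `A ⧸ I`. -/
def RegularMod (I : Ideal A) (x : A) : Prop :=
  ∀ r, x * r ∈ I → r ∈ I

/-- The list is a weakly regular sequence on `A ⧸ I`. -/
def RegularSeqMod : Ideal A → List A → Prop
  | _, [] => True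
  | I, x :: xs => RegularMod I x ∧ RegularSeqMod (I ⊔ Ideal.span {x}) xs

lemma mem_sup_span_singleton_iff {I : Ideal A} {x r : A} :
    r ∈ I ⊔ Ideal.span {x} ↔ ∃ w, r - x * w ∈ I := by
  rw [Submodule.mem_sup]
  constructor
  · rintro ⟨i, hi, y, hy, rfl⟩
    obtain ⟨w, rfl⟩ := Ideal.mem_span_singleton'.1 hy
    exact ⟨w, by rwa [mul_comm x, add_sub_cancel_right]⟩
  · rintro ⟨w, hw⟩
    exact ⟨_, hw, x * w, Ideal.mem_span_singleton'.2 ⟨w, mul_comm _ _⟩, by ring⟩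

lemma mem_left_of_sub_mem {I : Ideal A} {a b : A} (h : a - b ∈ I) (hb : b ∈ I) : a ∈ I := by
  simpa using I.add_mem h hb

lemma mem_sup_of_sub_mul_mem {I : Ideal A} {x r w : A} (h : r - x * w ∈ I) :
    r ∈ I ⊔ Ideal.span {x} :=
  mem_sup_span_singleton_iff.2 ⟨w, h⟩

/-- A regular element `x` on `A ⧸ J` satisfies `J ∩ (x) = x J`. -/
lemma le_sup_span_mul {I J : Ideal A} {x : A} (hx : RegularMod J x) (hIJ : I ≤ J)
    (h : J ≤ I ⊔ Ideal.span {x}) : J ≤ I ⊔ Ideal.span {x} * J := by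
  intro r hr
  obtain ⟨w, hw⟩ := mem_sup_span_singleton_iff.1 (h hr)
  have hxw : x * w ∈ J := by
    have := J.sub_mem hr (hIJ hw)
    simpa using this
  rw [Submodule.mem_sup]
  exact ⟨_, hw, x * w, Ideal.mul_mem_mul (Ideal.mem_span_singleton_self x) (hx w hxw), by ring⟩

lemma comap_sup_span_singleton {B : Type*} [CommRing B] (φ : A →+* B)
    (hφ : Function.Surjective φ) (K : Ideal B) (x : A) :
    (K ⊔ Ideal.span {φ x}).comap φ = K.comap φ ⊔ Ideal.span {x} := by
  ext r
  simp only [Ideal.mem_comap, mem_sup_span_singleton_iff, map_sub, map_mul]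
  exact (hφ.exists (p := fun w => φ r - φ x * w ∈ K))

lemma comap_sup_ofList {B : Type*} [CommRing B] (φ : A →+* B)
    (hφ : Function.Surjective φ) (K : Ideal B) (xs : List A) :
    (K ⊔ Ideal.ofList (xs.map φ)).comap φ = K.comap φ ⊔ Ideal.ofList xs := by
  induction xs generalizing K with
  | nil => simp
  | cons x xs ih => simp [← sup_assoc, ih, comap_sup_span_singleton φ hφ]

lemma regularMod_comap {B : Type*} [CommRing B] (φ : A →+* B)
    (hφ : Function.Surjective φ) (K : Ideal B) (x : A) :
    RegularMod (K.comap φ) x ↔ RegularMod K (φ x) := by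
  simp only [RegularMod, Ideal.mem_comap, map_mul]
  exact (hφ.forall (p := fun r => φ x * r ∈ K → r ∈ K)).symm

lemma regularSeqMod_comap {B : Type*} [CommRing B] (φ : A →+* B)
    (hφ : Function.Surjective φ) (K : Ideal B) (xs : List A) :
    RegularSeqMod (K.comap φ) xs ↔ RegularSeqMod K (xs.map φ) := by
  induction xs generalizing K with
  | nil => simp [RegularSeqMod]
  | cons x xs ih =>
    simp only [RegularSeqMod, List.map_cons, regularMod_comap φ hφ, ← ih,
      comap_sup_span_singleton φ hφ]

lemma regularMod_iff_isSMulRegular {I : Ideal A} {x : A} :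
    RegularMod I x ↔ IsSMulRegular (A ⧸ I) x := by
  rw [isSMulRegular_iff_right_eq_zero_of_smul]
  constructor
  · intro h m hm
    obtain ⟨r, rfl⟩ := Ideal.Quotient.mk_surjective m
    exact Ideal.Quotient.eq_zero_iff_mem.2 (h r (Ideal.Quotient.eq_zero_iff_mem.1 hm))
  · intro h r hr
    exact Ideal.Quotient.eq_zero_iff_mem.1 (h _ (Ideal.Quotient.eq_zero_iff_mem.2 hr))

/-- `(A ⧸ I) ⧸ x (A ⧸ I) ≃ A ⧸ (I + (x))`. -/
noncomputable def quotSMulTopQuotientEquiv (I : Ideal A) (x : A) :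
    QuotSMulTop x (A ⧸ I) ≃ₗ[A] A ⧸ (I ⊔ Ideal.span {x}) :=
  (Submodule.quotEquivOfEq _ _ (by
    ext m
    obtain ⟨r, rfl⟩ := Submodule.Quotient.mk_surjective _ m
    constructor
    · rintro hm
      obtain ⟨y, -, hy⟩ := (Submodule.mem_smul_pointwise_iff_exists _ _ _).1 hm
      rw [← hy]
      obtain ⟨s, rfl⟩ := Submodule.Quotient.mk_surjective _ y
      exact ⟨x * s, mem_sup_of_sub_mul_mem (w := s) (by simp), rfl⟩
    · rintro ⟨s, hs, hsr⟩
      obtain ⟨w, hw⟩ := mem_sup_span_singleton_iff.1 hs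
      rw [← hsr]
      refine (Submodule.mem_smul_pointwise_iff_exists _ _ _).2
        ⟨Submodule.Quotient.mk w, trivial, ?_⟩
      exact ((Submodule.Quotient.eq _).2 hw).symm)).trans
    (Submodule.quotientQuotientEquivQuotient I (I ⊔ Ideal.span {x}) le_sup_left)

lemma regularSeqMod_iff_isWeaklyRegular {I : Ideal A} {xs : List A} :
    RegularSeqMod I xs ↔ Sequence.IsWeaklyRegular (A ⧸ I) xs := by
  induction xs generalizing I with
  | nil => simp [RegularSeqMod]
  | cons x xs ih =>
    rw [RegularSeqMod, Sequence.isWeaklyRegular_cons_iff, regularMod_iff_isSMulRegular, ih,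
      (quotSMulTopQuotientEquiv I x).isWeaklyRegular_congr]

lemma regularSeqMod_bot_iff_isWeaklyRegular {xs : List A} :
    RegularSeqMod (⊥ : Ideal A) xs ↔ Sequence.IsWeaklyRegular A xs := by
  rw [regularSeqMod_iff_isWeaklyRegular]
  exact (Submodule.quotEquivOfEqBot (⊥ : Ideal A) rfl).isWeaklyRegular_congr xs

lemma isRegular_iff_regularSeqMod {xs : List A} :
    Sequence.IsRegular A xs ↔ RegularSeqMod (⊥ : Ideal A) xs ∧ Ideal.ofList xs ≠ ⊤ := by
  rw [Sequence.isRegular_iff, regularSeqMod_bot_iff_isWeaklyRegular, smul_eq_mul, Ideal.mul_top,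
    ne_comm]

lemma regularMod_colon {c I : Ideal A} {x : A} (hx : RegularMod c x) :
    RegularMod (Submodule.colon c (I : Set A)) x := by
  intro r hr
  rw [Submodule.mem_colon] at hr ⊢
  intro s hs
  refine hx _ ?_
  have := hr s hs
  rwa [smul_eq_mul, mul_assoc] at this

lemma le_colon_self (c I : Ideal A) : c ≤ Submodule.colon c (I : Set A) := fun _ hr =>
  Submodule.mem_colon.2 fun s _ => c.mul_mem_right s hr

lemma mem_colon_iff_mul_mem {c I : Ideal A} {r : A} :
    r ∈ Submodule.colon c (I : Set A) ↔ ∀ s ∈ I, r * s ∈ c :=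
  Submodule.mem_colon

lemma colon_sup_eq {c I K : Ideal A} (h : K ≤ c) :
    Submodule.colon c ((I ⊔ K : Ideal A) : Set A) = Submodule.colon c (I : Set A) := by
  ext r
  rw [mem_colon_iff_mul_mem, mem_colon_iff_mul_mem]
  refine ⟨fun hr s hs => hr s (Ideal.mem_sup_left hs), fun hr s hs => ?_⟩
  obtain ⟨i, hi, k, hk, rfl⟩ := Submodule.mem_sup.1 hs
  rw [mul_add]
  exact c.add_mem (hr i hi) (c.mul_mem_left _ (h hk))

lemma colon_comap {B : Type*} [CommRing B] (φ : A →+* B) (hφ : Function.Surjective φ)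
    (c K : Ideal B) :
    Submodule.colon (c.comap φ) (K.comap φ : Set A) =
      (Submodule.colon c (K : Set B)).comap φ := by
  ext r
  rw [Ideal.mem_comap, mem_colon_iff_mul_mem, mem_colon_iff_mul_mem]
  simp only [Ideal.mem_comap, map_mul]
  exact (hφ.forall (p := fun s => s ∈ K → φ r * s ∈ c)).symm

end IdealSequences

section LocalExchange

variable {A : Type*} [CommRing A] [IsLocalRing A]

/-- `u` is annihilated by the maximal ideal modulo `I`. -/
def SocleMod (I : Ideal A) (u : A) : Prop :=
  ∀ r ∈ maximalIdeal A, r * u ∈ I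

/-- The socle of `A ⧸ I` is a one-dimensional vector space over the residue field. -/
def SimpleSocle (I : Ideal A) : Prop :=
  ∃ s, s ∉ I ∧ SocleMod I s ∧ ∀ u, SocleMod I u → u ∈ I ⊔ Ideal.span {s}

/-- Some regular sequence of length `n` on `A ⧸ I` leads to an ideal satisfying `Q`. -/
def DepthTo (Q : Ideal A → Prop) : ℕ → Ideal A → Prop
  | 0, I => Q I
  | n + 1, I => ∃ x ∈ maximalIdeal A, RegularMod I x ∧ DepthTo Q n (I ⊔ Ideal.span {x})

/-- `A ⧸ I` is Artinian. -/
def IsArtinianMod (I : Ideal A) : Prop :=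
  maximalIdeal A ≤ I.radical

/-- `A ⧸ I` is Artinian with simple socle. -/
def IsGorensteinArtinianMod (I : Ideal A) : Prop :=
  IsArtinianMod I ∧ SimpleSocle I

lemma DepthTo.mono {P Q : Ideal A → Prop} (h : ∀ I, P I → Q I) {n : ℕ} {I : Ideal A}
    (hI : DepthTo P n I) : DepthTo Q n I := by
  induction n generalizing I with
  | zero => exact h I hI
  | succ n ih =>
    obtain ⟨x, hx, hr, hd⟩ := hI
    exact ⟨x, hx, hr, ih hd⟩

lemma DepthTo.of_regularSeqMod {Q : Ideal A → Prop} {I : Ideal A} {xs : List A}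
    (hm : ∀ x ∈ xs, x ∈ maximalIdeal A) (hxs : RegularSeqMod I xs)
    (hQ : Q (I ⊔ Ideal.ofList xs)) : DepthTo Q xs.length I := by
  induction xs generalizing I with
  | nil => simpa [DepthTo] using hQ
  | cons x xs ih =>
    refine ⟨x, hm x (by simp), hxs.1, ih (fun y hy => hm y (by simp [hy])) hxs.2 ?_⟩
    simpa [sup_assoc] using hQ

lemma RegularMod.mem_of_socleMod {I : Ideal A} {x u : A} (hx : x ∈ maximalIdeal A)
    (hr : RegularMod I x) (hu : SocleMod I u) : u ∈ I :=
  hr u (hu x hx)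

lemma RegularMod.exists_socleMod_exchange {I : Ideal A} {x y u : A}
    (hy : y ∈ maximalIdeal A) (hIx : RegularMod I x) (hIy : RegularMod I y)
    (hu : SocleMod (I ⊔ Ideal.span {x}) u) :
    ∃ v, y * u - x * v ∈ I ∧ SocleMod (I ⊔ Ideal.span {y}) v ∧
      (v ∈ I ⊔ Ideal.span {y} → u ∈ I ⊔ Ideal.span {x}) := by
  obtain ⟨v, hv⟩ := mem_sup_span_singleton_iff.1 (hu y hy)
  refine ⟨v, hv, fun r hr => ?_, fun h => ?_⟩
  · obtain ⟨w, hw⟩ := mem_sup_span_singleton_iff.1 (hu r hr)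
    refine mem_sup_of_sub_mul_mem (w := w) (hIx _ ?_)
    have := I.sub_mem (I.mul_mem_left y hw) (I.mul_mem_left r hv)
    convert this using 1
    ring
  · obtain ⟨w, hw⟩ := mem_sup_span_singleton_iff.1 h
    refine mem_sup_of_sub_mul_mem (w := w) (hIy _ ?_)
    have := I.add_mem hv (I.mul_mem_left x hw)
    convert this using 1
    ring

lemma SimpleSocle.exchange {I : Ideal A} {x y : A} (hx : x ∈ maximalIdeal A)
    (hy : y ∈ maximalIdeal A) (hIx : RegularMod I x) (hIy : RegularMod I y)
    (h : SimpleSocle (I ⊔ Ideal.span {x})) : SimpleSocle (I ⊔ Ideal.span {y}) := by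
  obtain ⟨s, hs, hsoc, huniq⟩ := h
  obtain ⟨t, hst, ht, htm⟩ := hIx.exists_socleMod_exchange hy hIy hsoc
  refine ⟨t, fun h => hs (htm h), ht, fun v hv => ?_⟩
  obtain ⟨u, hvu, hu, -⟩ := hIy.exists_socleMod_exchange hx hIx hv
  obtain ⟨r, hr⟩ := mem_sup_span_singleton_iff.1 (huniq u hu)
  obtain ⟨w, hw⟩ := mem_sup_span_singleton_iff.1 hr
  refine mem_sup_of_sub_mul_mem (w := r)
    (mem_sup_of_sub_mul_mem (w := w) (hIx _ ?_))
  have := I.add_mem (I.add_mem hvu (I.mul_mem_left y hw)) (I.mul_mem_left r hst)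
  convert this using 1
  ring

lemma IsGorensteinArtinianMod.not_regularMod {I : Ideal A} (h : IsGorensteinArtinianMod I) {x : A}
    (hx : x ∈ maximalIdeal A) : ¬ RegularMod I x := fun hr => by
  obtain ⟨s, hs, hsoc, -⟩ := h.2
  exact hs (hr.mem_of_socleMod hx hsoc)

lemma simpleSocle_of_infIrred [IsNoetherianRing A] {I : Ideal A} (hm : IsArtinianMod I)
    (hI : InfIrred I) : SimpleSocle I := by
  have htop : I ≠ ⊤ := fun h => hI.1 (h ▸ isMax_top)
  obtain ⟨n, hn⟩ := Ideal.exists_pow_le_of_le_radical_of_fg hm (IsNoetherian.noetherian _)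
  obtain ⟨s, hs, hsoc⟩ : ∃ s, s ∉ I ∧ SocleMod I s := by
    induction n with
    | zero => simp [htop] at hn
    | succ n ih =>
      by_cases h : maximalIdeal A ^ n ≤ I
      · exact ih h
      · obtain ⟨s, hs, hsI⟩ := SetLike.not_le_iff_exists.1 h
        refine ⟨s, hsI, fun r hr => hn ?_⟩
        rw [pow_succ']
        exact Ideal.mul_mem_mul hr hs
  refine ⟨s, hs, hsoc, fun u hu => ?_⟩
  by_cases huI : u ∈ I
  · exact Ideal.mem_sup_left huI
  have hlt : ∀ {v}, v ∉ I → I ⊔ Ideal.span {v} ≠ I := fun hv h =>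
    hv (h ▸ Ideal.mem_sup_right (Ideal.mem_span_singleton_self _))
  have hne : (I ⊔ Ideal.span {u}) ⊓ (I ⊔ Ideal.span {s}) ≠ I := fun h =>
    (hI.2 h).elim (hlt huI) (hlt hs)
  have hle : I ≤ (I ⊔ Ideal.span {u}) ⊓ (I ⊔ Ideal.span {s}) := le_inf le_sup_left le_sup_left
  obtain ⟨w, hw, hwI⟩ := SetLike.not_le_iff_exists.1 fun h => hne (le_antisymm h hle)
  obtain ⟨a, ha⟩ := mem_sup_span_singleton_iff.1 hw.1
  have hau : IsUnit a := by
    by_contra hna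
    refine hwI (mem_left_of_sub_mem ha ?_)
    rw [mul_comm]
    exact hu a ((mem_maximalIdeal a).2 hna)
  obtain ⟨b, hb⟩ := hau.exists_left_inv
  have hua : u * a ∈ I ⊔ Ideal.span {s} := by
    have := Ideal.sub_mem _ hw.2 (Ideal.mem_sup_left ha)
    simpa using this
  have := Ideal.mul_mem_left _ b hua
  convert this using 1
  linear_combination -u * hb

lemma span_singleton_le_maximalIdeal {x : A} (hx : x ∈ maximalIdeal A) :
    Ideal.span {x} ≤ maximalIdeal A := by
  simpa [Ideal.span_le] using hx

lemma DepthTo.mem_of_socleMod {Q : Ideal A → Prop} {n : ℕ} {I : Ideal A}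
    (h : DepthTo Q (n + 1) I) {u : A} (hu : SocleMod I u) : u ∈ I := by
  obtain ⟨x, hx, hr, -⟩ := h
  exact hr.mem_of_socleMod hx hu

variable [IsNoetherianRing A]

lemma le_of_le_sup_mul {I J K : Ideal A} (hK : K ≤ maximalIdeal A) (h : J ≤ I ⊔ K * J) :
    J ≤ I :=
  Submodule.le_of_le_smul_of_le_jacobson_bot (IsNoetherian.noetherian J)
    (hK.trans (maximalIdeal_le_jacobson _)) h

lemma RegularMod.le_of_le_sup_span {I J : Ideal A} {x : A} (hm : x ∈ maximalIdeal A)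
    (hx : RegularMod J x) (hIJ : I ≤ J) (h : J ≤ I ⊔ Ideal.span {x}) : J ≤ I :=
  le_of_le_sup_mul (span_singleton_le_maximalIdeal hm) (le_sup_span_mul hx hIJ h)

lemma RegularSeqMod.le_of_le_sup_ofList {I J : Ideal A} {xs : List A}
    (hm : ∀ x ∈ xs, x ∈ maximalIdeal A) (hxs : RegularSeqMod J xs) (hIJ : I ≤ J)
    (h : J ≤ I ⊔ Ideal.ofList xs) : J ≤ I := by
  induction xs generalizing I J with
  | nil => simpa using h
  | cons x xs ih =>
    refine hxs.1.le_of_le_sup_span (hm x (by simp)) hIJ (le_sup_left.trans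
      (ih (fun y hy => hm y (by simp [hy])) hxs.2 (sup_le_sup_right hIJ _) ?_))
    refine sup_le (h.trans ?_) ?_
    · simp [sup_assoc]
    · exact le_sup_of_le_left le_sup_right

lemma RegularMod.swap {I : Ideal A} {x y : A} (hm : x ∈ maximalIdeal A) (hx : RegularMod I x)
    (hy : RegularMod (I ⊔ Ideal.span {x}) y) :
    RegularMod I y ∧ RegularMod (I ⊔ Ideal.span {y}) x := by
  constructor
  · let N : Ideal A := Submodule.colon I ((Ideal.span {y} : Ideal A) : Set A)
    have hN : ∀ r, r ∈ N ↔ y * r ∈ I := fun r => by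
      rw [Ideal.mem_colon_span_singleton, mul_comm]
    have hle : N ≤ I := by
      refine RegularMod.le_of_le_sup_span (x := x) hm (fun r hr => ?_)
        (fun r hr => (hN r).2 (I.mul_mem_left _ hr))
        (fun r hr => hy r (Ideal.mem_sup_left ((hN r).1 hr)))
      rw [hN] at hr ⊢
      exact hx _ (by convert hr using 1; ring)
    exact fun r hr => hle ((hN r).2 hr)
  · intro r hr
    obtain ⟨s, hs⟩ := mem_sup_span_singleton_iff.1 hr
    obtain ⟨t, ht⟩ := mem_sup_span_singleton_iff.1 (hy s (mem_sup_span_singleton_iff.2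
      ⟨r, by convert I.neg_mem hs using 1; ring⟩))
    refine mem_sup_of_sub_mul_mem (w := t) (hx _ ?_)
    convert I.add_mem hs (I.mul_mem_left y ht) using 1
    ring

lemma RegularSeqMod.swap_append {I : Ideal A} {xs : List A} {y : A}
    (hm : ∀ x ∈ xs, x ∈ maximalIdeal A) (hxs : RegularSeqMod I xs)
    (hy : RegularMod (I ⊔ Ideal.ofList xs) y) :
    RegularMod I y ∧ RegularSeqMod (I ⊔ Ideal.span {y}) xs := by
  induction xs generalizing I with
  | nil => exact ⟨by simpa using hy, trivial⟩
  | cons x xs ih =>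
    obtain ⟨h1, h2⟩ := ih (fun z hz => hm z (by simp [hz])) hxs.2 (by simpa [sup_assoc] using hy)
    obtain ⟨h3, h4⟩ := hxs.1.swap (hm x (by simp)) h1
    exact ⟨h3, h4, by rwa [sup_right_comm]⟩

lemma RegularSeqMod.append_comm {I : Ideal A} {xs ys : List A}
    (hm : ∀ x ∈ xs, x ∈ maximalIdeal A) (hxs : RegularSeqMod I xs)
    (hys : RegularSeqMod (I ⊔ Ideal.ofList xs) ys) :
    RegularSeqMod I ys ∧ RegularSeqMod (I ⊔ Ideal.ofList ys) xs := by
  induction ys generalizing I with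
  | nil => exact ⟨trivial, by simpa using hxs⟩
  | cons y ys ih =>
    obtain ⟨h1, h2⟩ := hxs.swap_append hm hys.1
    obtain ⟨h3, h4⟩ := ih h2 (by rw [sup_right_comm]; exact hys.2)
    exact ⟨⟨h1, h3⟩, by simpa [sup_assoc] using h4⟩

lemma exists_regularMod_and_regularMod {I J : Ideal A} (hI : ∀ u, SocleMod I u → u ∈ I)
    (hJ : ∀ u, SocleMod J u → u ∈ J) :
    ∃ z ∈ maximalIdeal A, RegularMod I z ∧ RegularMod J z := by
  by_contra! hcon
  have hsub : (maximalIdeal A : Set A) ⊆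
      ⋃ p ∈ associatedPrimes A ((A ⧸ I) × (A ⧸ J)), (p : Set A) := by
    rw [biUnion_associatedPrimes_eq_zero_divisors]
    intro z hz
    by_cases hzI : RegularMod I z
    · have := hcon z hz hzI
      simp only [RegularMod, not_forall] at this
      obtain ⟨r, hr, hrJ⟩ := this
      exact ⟨(0, Ideal.Quotient.mk J r), fun h => hrJ (Ideal.Quotient.eq_zero_iff_mem.1
        (congrArg Prod.snd h)), Prod.ext (smul_zero _) (Ideal.Quotient.eq_zero_iff_mem.2 hr)⟩
    · simp only [RegularMod, not_forall] at hzI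
      obtain ⟨r, hr, hrI⟩ := hzI
      exact ⟨(Ideal.Quotient.mk I r, 0), fun h => hrI (Ideal.Quotient.eq_zero_iff_mem.1
        (congrArg Prod.fst h)), Prod.ext (Ideal.Quotient.eq_zero_iff_mem.2 hr) (smul_zero _)⟩
  obtain ⟨p, hp, hle⟩ := (Ideal.subset_union_prime_finite
    (associatedPrimes.finite A ((A ⧸ I) × (A ⧸ J))) (f := id) 0 0
    fun _ h _ _ => h.1).1 hsub
  obtain ⟨hprime, ⟨u, v⟩, huv⟩ := isAssociatedPrime_iff.1 hp
  obtain ⟨u, rfl⟩ := Ideal.Quotient.mk_surjective u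
  obtain ⟨v, rfl⟩ := Ideal.Quotient.mk_surjective v
  have hann : ∀ r ∈ maximalIdeal A, r * u ∈ I ∧ r * v ∈ J := fun r hr => by
    have := hle hr
    rw [id, huv, Submodule.mem_colon_singleton, Submodule.mem_bot] at this
    exact ⟨Ideal.Quotient.eq_zero_iff_mem.1 (congrArg Prod.fst this),
      Ideal.Quotient.eq_zero_iff_mem.1 (congrArg Prod.snd this)⟩
  refine hprime.ne_top ((Ideal.eq_top_iff_one _).2 ?_)
  rw [huv, Submodule.mem_colon_singleton, one_smul, Submodule.mem_bot]
  exact Prod.ext (Ideal.Quotient.eq_zero_iff_mem.2 (hI u fun r hr => (hann r hr).1))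
    (Ideal.Quotient.eq_zero_iff_mem.2 (hJ v fun r hr => (hann r hr).2))

/-- The length of a regular sequence leading to `Q` does not depend on the choice of its
elements, provided `Q` is insensitive to replacing a single regular element. -/
lemma DepthTo.sup_span {Q : Ideal A → Prop}
    (hQ : ∀ (I : Ideal A) (x y : A), x ∈ maximalIdeal A → y ∈ maximalIdeal A → RegularMod I x →
      RegularMod I y → Q (I ⊔ Ideal.span {x}) → Q (I ⊔ Ideal.span {y}))
    {n : ℕ} {I : Ideal A} (h : DepthTo Q (n + 1) I) {y : A} (hy : y ∈ maximalIdeal A)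
    (hr : RegularMod I y) : DepthTo Q n (I ⊔ Ideal.span {y}) := by
  induction n generalizing I y with
  | zero =>
    obtain ⟨x, hx, hIx, hd⟩ := h
    exact hQ I x y hx hy hIx hr hd
  | succ n ih =>
    obtain ⟨x, hx, hIx, hd⟩ := h
    have hsx : ∀ u, SocleMod (I ⊔ Ideal.span {x}) u → u ∈ I ⊔ Ideal.span {x} :=
      fun u hu => hd.mem_of_socleMod hu
    have hsy : ∀ u, SocleMod (I ⊔ Ideal.span {y}) u → u ∈ I ⊔ Ideal.span {y} := fun u hu => by
      obtain ⟨v, -, hv, hvu⟩ := hr.exists_socleMod_exchange hx hIx hu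
      exact hvu (hsx v hv)
    obtain ⟨z, hz, hzx, hzy⟩ := exists_regularMod_and_regularMod hsx hsy
    have hxz := hIx.swap hx hzx
    have hyz := hr.swap hy hzy
    have h1 : DepthTo Q n (I ⊔ Ideal.span {x} ⊔ Ideal.span {z}) := ih hd hz hzx
    rw [sup_right_comm] at h1
    have h2 := ih (I := I ⊔ Ideal.span {z}) ⟨x, hx, hxz.2, h1⟩ hy hyz.2
    rw [sup_right_comm] at h2
    exact ⟨z, hz, hzy, h2⟩

end LocalExchange

section ArtinianDuality

variable {A : Type*} [CommRing A] [IsLocalRing A]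

lemma isArtinianMod_iff_krullDimLE_zero {I : Ideal A} :
    IsArtinianMod I ↔ Ring.KrullDimLE 0 (A ⧸ I) := by
  rw [Ideal.krullDimLE_zero_quotient_iff_forall_minimalPrimes_isMaximal, IsArtinianMod]
  constructor
  · intro h J hJ
    have hJp : J.IsPrime := hJ.1.1
    have : maximalIdeal A ≤ J := h.trans ((Ideal.radical_mono hJ.1.2).trans hJp.radical.le)
    rw [← (maximalIdeal.isMaximal A).eq_of_le hJp.ne_top this]
    exact maximalIdeal.isMaximal A
  · intro h
    rw [← Ideal.sInf_minimalPrimes]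
    exact le_sInf fun J hJ => (eq_maximalIdeal (h J hJ)).ge

lemma isArtinianMod_iff_ringKrullDim_le_zero {I : Ideal A} :
    IsArtinianMod I ↔ ringKrullDim (A ⧸ I) ≤ 0 := by
  rw [isArtinianMod_iff_krullDimLE_zero, Ring.krullDimLE_iff, Nat.cast_zero]

lemma IsArtinianMod.mono {I J : Ideal A} (hIJ : I ≤ J) (h : IsArtinianMod I) : IsArtinianMod J :=
  h.trans (Ideal.radical_mono hIJ)

lemma IsArtinianMod.exchange [IsNoetherianRing A] (I : Ideal A) (x y : A)
    (hx : x ∈ maximalIdeal A) (hy : y ∈ maximalIdeal A) (hIx : RegularMod I x)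
    (hIy : RegularMod I y) (h : IsArtinianMod (I ⊔ Ideal.span {x})) :
    IsArtinianMod (I ⊔ Ideal.span {y}) := by
  have key : ∀ z ∈ maximalIdeal A, RegularMod I z →
      ringKrullDim (A ⧸ (I ⊔ Ideal.span {z})) + 1 = ringKrullDim (A ⧸ I) := fun z hz hr => by
    have := Module.supportDim_quotSMulTop_succ_eq_supportDim
      (regularMod_iff_isSMulRegular.1 hr) hz
    rwa [Module.supportDim_eq_of_equiv (quotSMulTopQuotientEquiv I z),
      Module.supportDim_quotient_eq_ringKrullDim,
      Module.supportDim_quotient_eq_ringKrullDim] at this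
  rw [isArtinianMod_iff_ringKrullDim_le_zero] at h ⊢
  rwa [← ENat.WithBot.add_one_cancel.1 ((key x hx hIx).trans (key y hy hIy).symm)]

lemma IsGorensteinArtinianMod.exchange [IsNoetherianRing A] (I : Ideal A) (x y : A)
    (hx : x ∈ maximalIdeal A) (hy : y ∈ maximalIdeal A) (hIx : RegularMod I x)
    (hIy : RegularMod I y) (h : IsGorensteinArtinianMod (I ⊔ Ideal.span {x})) :
    IsGorensteinArtinianMod (I ⊔ Ideal.span {y}) :=
  ⟨IsArtinianMod.exchange I x y hx hy hIx hIy h.1, h.2.exchange hx hy hIx hIy⟩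

lemma IsArtinianMod.isFiniteLength [IsNoetherianRing A] {I : Ideal A} (h : IsArtinianMod I) :
    IsFiniteLength A (A ⧸ I) := by
  have := isArtinianMod_iff_krullDimLE_zero.1 h
  have h1 : IsArtinianRing (A ⧸ I) := isArtinianRing_iff_krullDimLE_zero.2 this
  rw [← Module.length_ne_top_iff,
    Module.length_eq_of_surjective (M := A ⧸ I) (S := A) (R := A ⧸ I) Ideal.Quotient.mk_surjective,
    Module.length_ne_top_iff]
  exact (isArtinianRing_iff_isFiniteLength _).1 h1

lemma length_linearMap_quotient_le_one {I : Ideal A} (hI : SimpleSocle I) (S : Type*)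
    [AddCommGroup S] [Module A S] [IsSimpleModule A S] :
    Module.length A (S →ₗ[A] A ⧸ I) ≤ 1 := by
  obtain ⟨s, -, hs, huniq⟩ := hI
  have := IsSimpleModule.nontrivial A S
  obtain ⟨v, hv⟩ := exists_ne (0 : S)
  have hker : LinearMap.ker (LinearMap.toSpanSingleton A S v) = maximalIdeal A :=
    eq_maximalIdeal (IsSimpleModule.ker_toSpanSingleton_isMaximal A hv)
  have hmv : ∀ r ∈ maximalIdeal A, r • v = 0 := fun r hr => by
    rw [← hker] at hr
    simpa using hr
  let L : Submodule A (A ⧸ I) := Submodule.span A {Ideal.Quotient.mk I s}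
  have hmem : ∀ f : S →ₗ[A] A ⧸ I, f v ∈ L := fun f => by
    obtain ⟨u, hu⟩ := Ideal.Quotient.mk_surjective (f v)
    have hsoc : SocleMod I u := fun r hr => by
      rw [← Ideal.Quotient.eq_zero_iff_mem, map_mul, hu]
      have : r • f v = 0 := by rw [← map_smul, hmv r hr, map_zero]
      exact this
    obtain ⟨w, hw⟩ := mem_sup_span_singleton_iff.1 (huniq u hsoc)
    rw [← hu, Ideal.Quotient.eq.2 hw, mul_comm]
    exact Submodule.mem_span_singleton.2 ⟨w, rfl⟩
  let ev : (S →ₗ[A] A ⧸ I) →ₗ[A] L := (LinearMap.applyₗ v).codRestrict L hmem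
  have hev : Function.Injective ev := by
    rw [injective_iff_map_eq_zero]
    intro f hf
    have hfv : f v = 0 := congrArg Subtype.val hf
    ext w
    obtain ⟨r, rfl⟩ := IsSimpleModule.toSpanSingleton_surjective A hv w
    simp [hfv]
  refine (Module.length_le_of_injective ev hev).trans ?_
  let g : (A ⧸ maximalIdeal A) →ₗ[A] A ⧸ I :=
    Submodule.liftQ _ (LinearMap.toSpanSingleton A (A ⧸ I) (Ideal.Quotient.mk I s))
      fun r hr => Ideal.Quotient.eq_zero_iff_mem.2 (hs r hr)
  have hg : LinearMap.range g = L :=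
    (Submodule.range_liftQ _ _ _).trans (LinearMap.range_toSpanSingleton _)
  have : IsSimpleModule A (A ⧸ maximalIdeal A) :=
    isSimpleModule_iff_isCoatom.2 (maximalIdeal.isMaximal A).out
  rw [← hg]
  exact (Module.length_le_of_surjective g.rangeRestrict g.surjective_rangeRestrict).trans
    (Module.length_eq_one A _).le

lemma length_eq_length_ker_add_length_range {R M P : Type*} [Ring R] [AddCommGroup M]
    [AddCommGroup P] [Module R M] [Module R P] (f : M →ₗ[R] P) :
    Module.length R M = Module.length R (LinearMap.ker f) + Module.length R (LinearMap.range f) :=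
  Module.length_eq_add_of_exact (LinearMap.ker f).subtype f.rangeRestrict
    (Submodule.subtype_injective _) f.surjective_rangeRestrict
    (by rw [LinearMap.exact_iff, LinearMap.ker_rangeRestrict, Submodule.range_subtype])

lemma length_ker_lcomp_subtype_le {R M E : Type*} [CommRing R] [AddCommGroup M] [Module R M]
    [AddCommGroup E] [Module R E] (N : Submodule R M) :
    Module.length R (LinearMap.ker (LinearMap.lcomp R E N.subtype)) ≤
      Module.length R (M ⧸ N →ₗ[R] E) := by
  have hle : LinearMap.ker (LinearMap.lcomp R E N.subtype) ≤
      LinearMap.range (LinearMap.lcomp R E N.mkQ) := fun f hf => by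
    refine ⟨N.liftQ f fun n hn => ?_, by ext; simp⟩
    exact LinearMap.congr_fun hf (⟨n, hn⟩ : N)
  exact (Module.length_le_of_injective (Submodule.inclusion hle)
    (Submodule.inclusion_injective hle)).trans (Module.length_le_of_surjective
      (LinearMap.lcomp R E N.mkQ).rangeRestrict (LinearMap.surjective_rangeRestrict _))

lemma length_linearMap_quotient_le {I : Ideal A} (hI : SimpleSocle I) {M : Type*}
    [AddCommGroup M] [Module A M] (hM : IsFiniteLength A M) :
    Module.length A (M →ₗ[A] A ⧸ I) ≤ Module.length A M := by
  induction hM with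
  | of_subsingleton => simp [Module.length_eq_zero]
  | @of_simple_quotient M _ _ N _ _ ih =>
    rw [length_eq_length_ker_add_length_range (LinearMap.lcomp A (A ⧸ I) N.subtype),
      Module.length_eq_add_of_exact N.subtype N.mkQ N.subtype_injective N.mkQ_surjective
        (LinearMap.exact_subtype_mkQ N), add_comm]
    refine add_le_add ((Module.length_le_of_injective _
      (Submodule.subtype_injective _)).trans ih) ?_
    rw [Module.length_eq_one A (M ⧸ N)]
    exact (length_ker_lcomp_subtype_le N).trans (length_linearMap_quotient_le_one hI _)

/-- An Artinian local ring with simple socle is self-injective. -/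
lemma IsGorensteinArtinianMod.exists_extend [IsNoetherianRing A] {I : Ideal A}
    (hI : IsGorensteinArtinianMod I) (N : Submodule A (A ⧸ I)) (f : N →ₗ[A] A ⧸ I) :
    ∃ g : (A ⧸ I) →ₗ[A] A ⧸ I, ∀ n : N, g n = f n := by
  have hfin := hI.1.isFiniteLength
  have hN : IsFiniteLength A N := hfin.of_injective N.subtype_injective
  have hQ : IsFiniteLength A ((A ⧸ I) ⧸ N) := hfin.of_surjective N.mkQ_surjective
  let ρ := LinearMap.lcomp A (A ⧸ I) N.subtype
  have hEnd : Module.length A (A ⧸ I) ≤ Module.length A ((A ⧸ I) →ₗ[A] A ⧸ I) := by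
    let μ : (A ⧸ I) →ₗ[A] (A ⧸ I) →ₗ[A] A ⧸ I := LinearMap.mul A (A ⧸ I)
    refine Module.length_le_of_injective μ fun a b hab => ?_
    simpa [μ] using LinearMap.congr_fun hab 1
  have hker : Module.length A (LinearMap.ker ρ) ≤ Module.length A ((A ⧸ I) ⧸ N) :=
    (length_ker_lcomp_subtype_le N).trans (length_linearMap_quotient_le hI.2 hQ)
  have hHom : Module.length A (N →ₗ[A] A ⧸ I) ≤ Module.length A N :=
    length_linearMap_quotient_le hI.2 hN
  have hsum := Module.length_eq_add_of_exact N.subtype N.mkQ N.subtype_injective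
    N.mkQ_surjective (LinearMap.exact_subtype_mkQ N)
  have hρ := length_eq_length_ker_add_length_range ρ
  have hrange : Module.length A (N →ₗ[A] A ⧸ I) ≤ Module.length A (LinearMap.range ρ) := by
    refine hHom.trans ?_
    have h1 : Module.length A N + Module.length A ((A ⧸ I) ⧸ N) ≤
        Module.length A (LinearMap.range ρ) + Module.length A ((A ⧸ I) ⧸ N) := by
      rw [← hsum, add_comm]
      exact (hEnd.trans hρ.le).trans (add_le_add_left hker _)
    exact (ENat.add_le_add_iff_right (Module.length_ne_top_iff.2 hQ)).1 h1
  have hHomfin : IsFiniteLength A (N →ₗ[A] A ⧸ I) := by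
    rw [← Module.length_ne_top_iff]
    exact ne_top_of_le_ne_top (Module.length_ne_top_iff.2 hN) hHom
  have htop : LinearMap.range ρ = ⊤ := by
    by_contra hne
    obtain ⟨_, _⟩ := isFiniteLength_iff_isNoetherian_isArtinian.1 hHomfin
    exact (Submodule.length_lt hne).not_ge hrange
  obtain ⟨g, hg⟩ := LinearMap.range_eq_top.1 htop f
  exact ⟨g, fun n => LinearMap.congr_fun hg n⟩

end ArtinianDuality

section HomExtension

variable {A : Type*} [CommRing A]

/-- Every homomorphism from `(I + c) ⧸ c` to `A ⧸ c` is multiplication by an element of `A`. -/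
def HomExtends (c I : Ideal A) : Prop :=
  ∀ f : I →ₗ[A] A ⧸ c, (∀ j : I, (j : A) ∈ c → f j = 0) →
    ∃ b : A, f = b • c.mkQ.comp I.subtype

lemma colon_sup_span_le (c I : Ideal A) (x : A) :
    Submodule.colon c (I : Set A) ⊔ Ideal.span {x} ≤
      Submodule.colon (c ⊔ Ideal.span {x}) (I : Set A) := by
  refine sup_le (fun r hr => mem_colon_iff_mul_mem.2 fun s hs =>
    Ideal.mem_sup_left (mem_colon_iff_mul_mem.1 hr s hs)) fun r hr =>
    le_colon_self _ _ (Ideal.mem_sup_right hr)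

/-- A homomorphism with image in `x (A ⧸ c)` is divisible by `x` when `x` is regular on
`A ⧸ c`. -/
lemma exists_eq_smul_of_forall_mem_span {c : Ideal A} {x : A} (hx : RegularMod c x)
    {M : Type*} [AddCommGroup M] [Module A M] (f : M →ₗ[A] A ⧸ c)
    (hf : ∀ m, ∃ r ∈ Ideal.span {x}, f m = Ideal.Quotient.mk c r) :
    ∃ g : M →ₗ[A] A ⧸ c, f = x • g := by
  let μ : (A ⧸ c) →ₗ[A] A ⧸ c := LinearMap.lsmul A _ x
  have hμ : Function.Injective μ := regularMod_iff_isSMulRegular.1 hx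
  have hr : ∀ m, f m ∈ LinearMap.range μ := fun m => by
    obtain ⟨r, hr, hm⟩ := hf m
    obtain ⟨w, rfl⟩ := Ideal.mem_span_singleton'.1 hr
    refine ⟨Ideal.Quotient.mk c w, ?_⟩
    rw [hm, mul_comm]
    rfl
  refine ⟨(LinearEquiv.ofInjective μ hμ).symm.toLinearMap.comp (f.codRestrict _ hr), ?_⟩
  ext m
  have := congrArg Subtype.val
    ((LinearEquiv.ofInjective μ hμ).apply_symm_apply (f.codRestrict _ hr m))
  exact this.symm

lemma HomExtends.colon_sup_span {c I : Ideal A} {x : A} (h : HomExtends c I)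
    (hx : RegularMod c x) :
    Submodule.colon (c ⊔ Ideal.span {x}) (I : Set A) =
      Submodule.colon c (I : Set A) ⊔ Ideal.span {x} := by
  refine le_antisymm (fun b hb => ?_) (colon_sup_span_le c I x)
  rw [mem_colon_iff_mul_mem] at hb
  obtain ⟨g, hg⟩ := exists_eq_smul_of_forall_mem_span hx (b • c.mkQ.comp I.subtype) fun j => by
    obtain ⟨w, hw⟩ := mem_sup_span_singleton_iff.1 (hb j j.2)
    exact ⟨x * w, Ideal.mem_span_singleton'.2 ⟨w, mul_comm _ _⟩, Ideal.Quotient.eq.2 hw⟩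
  obtain ⟨a, rfl⟩ := h g fun j hj => by
    refine regularMod_iff_isSMulRegular.1 hx ?_
    have : b • Ideal.Quotient.mk c (j : A) = x • g j := LinearMap.congr_fun hg j
    change x • g j = x • 0
    rw [← this, Ideal.Quotient.eq_zero_iff_mem.2 hj, smul_zero, smul_zero]
  refine mem_sup_span_singleton_iff.2 ⟨a, mem_colon_iff_mul_mem.2 fun s hs => ?_⟩
  have : Ideal.Quotient.mk c (b * s) = Ideal.Quotient.mk c (x * (a * s)) :=
    LinearMap.congr_fun hg ⟨s, hs⟩
  rw [Ideal.Quotient.eq] at this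
  rwa [sub_mul, mul_assoc]

lemma RegularMod.mem_of_pow_mul_mem {c : Ideal A} {x r : A} (hx : RegularMod c x) {n : ℕ}
    (h : x ^ n * r ∈ c) : r ∈ c := by
  induction n with
  | zero => simpa using h
  | succ n ih => exact ih (hx _ (by rwa [← mul_assoc, ← pow_succ']))

/-- The homomorphisms `(I + c) ⧸ c → A ⧸ c`. -/
def homKilling (c I : Ideal A) : Submodule A (I →ₗ[A] A ⧸ c) where
  carrier := {f | ∀ j : I, (j : A) ∈ c → f j = 0}
  add_mem' := fun hf hg j hj => by simp [hf j hj, hg j hj]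
  zero_mem' := fun _ _ => rfl
  smul_mem' := fun a f hf j hj => by simp [hf j hj]

variable [IsLocalRing A] [IsNoetherianRing A]

lemma HomExtends.of_sup_span {c I : Ideal A} {x : A} (hm : x ∈ maximalIdeal A)
    (hx : RegularMod c x) (hxI : RegularMod (I ⊔ c) x) (h : HomExtends (c ⊔ Ideal.span {x}) I) :
    HomExtends c I := by
  let θ : I →ₗ[A] A ⧸ c := c.mkQ.comp I.subtype
  have key : homKilling c I ≤ Submodule.span A {θ} ⊔ Ideal.span {x} • homKilling c I := by
    intro f hf
    let p : (A ⧸ c) →ₗ[A] A ⧸ (c ⊔ Ideal.span {x}) := Submodule.factor le_sup_left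
    have hp : ∀ a : A, p (Ideal.Quotient.mk c a) = Ideal.Quotient.mk _ a := fun _ => rfl
    obtain ⟨b, hb⟩ := h (p.comp f) fun j hj => by
      obtain ⟨w, hw⟩ := mem_sup_span_singleton_iff.1 hj
      have hw' : w ∈ I ⊔ c := hxI w <| by
        rw [← sub_sub_cancel (j : A) (x * w)]
        exact sub_mem (Ideal.mem_sup_left j.2) (Ideal.mem_sup_right hw)
      obtain ⟨j', hj', i, hi, rfl⟩ := Submodule.mem_sup.1 hw'
      have h0 : f (j - x • ⟨j', hj'⟩) = 0 := hf _ <| by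
        have : (j : A) - x * j' = j - x * (j' + i) + x * i := by ring
        change (j : A) - x * j' ∈ c
        rw [this]
        exact add_mem hw (c.mul_mem_left _ hi)
      rw [map_sub, map_smul, sub_eq_zero] at h0
      obtain ⟨a, ha⟩ := Ideal.Quotient.mk_surjective (f ⟨j', hj'⟩)
      rw [LinearMap.comp_apply, h0, map_smul, ← ha, hp]
      exact Ideal.Quotient.eq_zero_iff_mem.2
        (Ideal.mem_sup_right (Ideal.mul_mem_right _ _ (Ideal.mem_span_singleton_self x)))
    obtain ⟨g, hg⟩ := exists_eq_smul_of_forall_mem_span hx (f - b • θ) fun j => by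
      obtain ⟨a, ha⟩ := Ideal.Quotient.mk_surjective (f j)
      have h1 : Ideal.Quotient.mk (c ⊔ Ideal.span {x}) a = Ideal.Quotient.mk _ (b * j) := by
        rw [← hp, ha]
        exact LinearMap.congr_fun hb j
      obtain ⟨w, hw⟩ := mem_sup_span_singleton_iff.1 (Ideal.Quotient.eq.1 h1)
      refine ⟨x * w, Ideal.mem_span_singleton'.2 ⟨w, mul_comm _ _⟩, ?_⟩
      rw [← Ideal.Quotient.eq.2 hw, map_sub, ha]
      rfl
    rw [sub_eq_iff_eq_add'] at hg
    rw [hg]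
    refine add_mem (Submodule.mem_sup_left (Submodule.smul_mem _ _
      (Submodule.mem_span_singleton_self θ))) (Submodule.mem_sup_right
        (Submodule.smul_mem_smul (Ideal.mem_span_singleton_self x) fun j hj => ?_))
    refine regularMod_iff_isSMulRegular.1 hx ?_
    have h1 : f j = b • Ideal.Quotient.mk c (j : A) + x • g j := LinearMap.congr_fun hg j
    rw [hf j hj, Ideal.Quotient.eq_zero_iff_mem.2 hj, smul_zero, zero_add] at h1
    change x • g j = x • 0
    rw [← h1, smul_zero]
  have := Submodule.le_of_le_smul_of_le_jacobson_bot (IsNoetherian.noetherian _)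
    ((span_singleton_le_maximalIdeal hm).trans (maximalIdeal_le_jacobson _)) key
  intro f hf
  obtain ⟨b, hb⟩ := Submodule.mem_span_singleton.1 (this hf)
  exact ⟨b, hb.symm⟩

lemma IsGorensteinArtinianMod.homExtends {c : Ideal A} (hc : IsGorensteinArtinianMod c)
    (I : Ideal A) : HomExtends c I := by
  intro f hf
  let q : I →ₗ[A] Submodule.map c.mkQ I := c.mkQ.submoduleMap I
  have hq : Function.Surjective q := c.mkQ.submoduleMap_surjective I
  have hker : LinearMap.ker q ≤ LinearMap.ker f := fun j hj =>
    hf j (Ideal.Quotient.eq_zero_iff_mem.1 (congrArg Subtype.val hj))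
  let f' : Submodule.map c.mkQ I →ₗ[A] A ⧸ c :=
    ((LinearMap.ker q).liftQ f hker).comp (q.quotKerEquivOfSurjective hq).symm.toLinearMap
  have hf' : ∀ j, f' (q j) = f j := fun j => by
    have : (q.quotKerEquivOfSurjective hq).symm (q j) = Submodule.Quotient.mk j :=
      (LinearEquiv.symm_apply_eq _).2 rfl
    simp [f', this]
  obtain ⟨g, hg⟩ := hc.exists_extend _ f'
  obtain ⟨b, hb⟩ := Ideal.Quotient.mk_surjective (g 1)
  refine ⟨b, LinearMap.ext fun j => ?_⟩
  have h1 : g (q j : A ⧸ c) = f j := (hg _).trans (hf' j)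
  have h2 : (q j : A ⧸ c) = (j : A) • (1 : A ⧸ c) := by
    change Ideal.Quotient.mk c j = _
    rw [Algebra.smul_def, mul_one]
    rfl
  rw [← h1, h2, map_smul, ← hb]
  change Ideal.Quotient.mk c (j * b) = Ideal.Quotient.mk c (b * j)
  rw [mul_comm]

lemma DepthTo.homExtends {n : ℕ} {c I : Ideal A} (hc : DepthTo IsGorensteinArtinianMod n c)
    (hI : DepthTo (fun _ => True) n (I ⊔ c)) : HomExtends c I := by
  induction n generalizing c with
  | zero => exact IsGorensteinArtinianMod.homExtends hc I
  | succ n ih =>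
    obtain ⟨z, hz, hcz, hIz⟩ := exists_regularMod_and_regularMod
      (fun _ => hc.mem_of_socleMod) (fun _ => hI.mem_of_socleMod)
    refine .of_sup_span hz hcz hIz (ih (hc.sup_span IsGorensteinArtinianMod.exchange hz hcz) ?_)
    rw [← sup_assoc]
    exact hI.sup_span (fun _ _ _ _ _ _ _ _ => trivial) hz hIz

lemma HomExtends.of_sup_ofList {c I : Ideal A} {xs : List A}
    (hm : ∀ x ∈ xs, x ∈ maximalIdeal A) (hc : RegularSeqMod c xs)
    (hI : RegularSeqMod (I ⊔ c) xs) (h : HomExtends (c ⊔ Ideal.ofList xs) I) :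
    HomExtends c I ∧ RegularSeqMod (Submodule.colon c (I : Set A)) xs ∧
      Submodule.colon c (I : Set A) ⊔ Ideal.ofList xs =
        Submodule.colon (c ⊔ Ideal.ofList xs) (I : Set A) := by
  induction xs generalizing c with
  | nil => exact ⟨by simpa using h, trivial, by simp⟩
  | cons x xs ih =>
    rw [Ideal.ofList_cons, ← sup_assoc] at h ⊢
    obtain ⟨h1, h2, h3⟩ := ih (fun y hy => hm y (by simp [hy])) hc.2
      (by rw [← sup_assoc]; exact hI.2) h
    have h4 := HomExtends.of_sup_span (hm x (by simp)) hc.1 hI.1 h1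
    rw [h4.colon_sup_span hc.1] at h2 h3
    exact ⟨h4, ⟨regularMod_colon hc.1, h2⟩, by rw [← sup_assoc, h3]⟩

lemma DepthTo.isArtinianMod_colon {n : ℕ} {c I : Ideal A}
    (hc : DepthTo IsGorensteinArtinianMod n c) (hI : DepthTo IsArtinianMod n I) (hcI : c ≤ I) :
    DepthTo IsArtinianMod n (Submodule.colon c (I : Set A)) := by
  induction n generalizing c I with
  | zero => exact IsArtinianMod.mono (le_colon_self c I) hc.1
  | succ n ih =>
    obtain ⟨z, hz, hcz, hIz⟩ := exists_regularMod_and_regularMod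
      (fun _ => hc.mem_of_socleMod) (fun _ => hI.mem_of_socleMod)
    have hcI' : I ⊔ c = I := sup_eq_left.2 hcI
    have hext : HomExtends c I :=
      hc.homExtends (by rw [hcI']; exact hI.mono fun _ _ => trivial)
    refine ⟨z, hz, regularMod_colon hcz, ?_⟩
    rw [← hext.colon_sup_span hcz, ← colon_sup_eq (I := I) le_sup_right]
    exact ih (hc.sup_span IsGorensteinArtinianMod.exchange hz hcz)
      (hI.sup_span IsArtinianMod.exchange hz hIz) (sup_le_sup_right hcI _)

lemma DepthTo.isArtinianMod_of_colon {n d : ℕ} {c I : Ideal A}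
    (hc : DepthTo IsGorensteinArtinianMod n c) (hI : DepthTo IsArtinianMod d I) (hcI : c ≤ I)
    (hne : I ≠ ⊤) (hcolon : ¬ Submodule.colon c (I : Set A) ≤ c) :
    DepthTo IsArtinianMod n I := by
  induction n generalizing c I d with
  | zero => exact IsArtinianMod.mono hcI hc.1
  | succ n ih =>
    obtain _ | d := d
    · refine absurd (fun u hu => ?_) hcolon
      obtain ⟨z, hz, hcz, -⟩ := hc
      obtain ⟨k, hk⟩ := (show IsArtinianMod I from hI) hz
      refine hcz.mem_of_pow_mul_mem (n := k) ?_
      rw [mul_comm]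
      exact mem_colon_iff_mul_mem.1 hu _ hk
    · obtain ⟨z, hz, hcz, hIz⟩ := exists_regularMod_and_regularMod
        (fun _ => hc.mem_of_socleMod) (fun _ => hI.mem_of_socleMod)
      refine ⟨z, hz, hIz, ih (hc.sup_span IsGorensteinArtinianMod.exchange hz hcz)
        (hI.sup_span IsArtinianMod.exchange hz hIz) (sup_le_sup_right hcI _) ?_ fun hle => ?_⟩
      · exact ((sup_le (le_maximalIdeal hne) (span_singleton_le_maximalIdeal hz)).trans_lt
          (maximalIdeal.isMaximal A).ne_top.lt_top).ne
      · rw [colon_sup_eq le_sup_right] at hle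
        exact hcolon ((regularMod_colon hcz).le_of_le_sup_span hz (le_colon_self c I)
          ((le_sup_left.trans (colon_sup_span_le c I z)).trans hle))

end HomExtension

section Deformation

lemma DepthTo.sup_ofList {A : Type*} [CommRing A] [IsLocalRing A] [IsNoetherianRing A] {n : ℕ}
    {I : Ideal A} (h : DepthTo IsGorensteinArtinianMod n I) {xs : List A}
    (hm : ∀ x ∈ xs, x ∈ maximalIdeal A) (hxs : RegularSeqMod I xs) :
    ∃ e, DepthTo IsGorensteinArtinianMod e (I ⊔ Ideal.ofList xs) := by
  induction xs generalizing n I with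
  | nil => exact ⟨n, by simpa using h⟩
  | cons x xs ih =>
    obtain _ | n := n
    · exact (IsGorensteinArtinianMod.not_regularMod h (hm x (by simp)) hxs.1).elim
    · obtain ⟨e, he⟩ := ih (h.sup_span IsGorensteinArtinianMod.exchange (hm x (by simp)) hxs.1)
        (fun y hy => hm y (by simp [hy])) hxs.2
      exact ⟨e, by rwa [Ideal.ofList_cons, ← sup_assoc]⟩

lemma exists_list_map_eq {R S : Type*} [CommRing R] [CommRing S] {π : S →+* R}
    (hsurj : Function.Surjective π) {J : Ideal S} {α : List R} (hα : ∀ r ∈ α, r ∈ J.map π) :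
    ∃ a : List S, a.map π = α ∧ ∀ s ∈ a, s ∈ J := by
  induction α with
  | nil => exact ⟨[], rfl, by simp⟩
  | cons r α ih =>
    obtain ⟨a, rfl, ha⟩ := ih fun s hs => hα s (by simp [hs])
    obtain ⟨s, hs, rfl⟩ := (Ideal.mem_map_iff_of_surjective π hsurj).1 (hα r (by simp))
    exact ⟨s :: a, rfl, by simpa [hs] using ha⟩

lemma ofList_le {A : Type*} [CommRing A] {xs : List A} {I : Ideal A} (h : ∀ x ∈ xs, x ∈ I) :
    Ideal.ofList xs ≤ I :=
  Ideal.span_le.2 h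

lemma mem_ofList {A : Type*} [CommRing A] {xs : List A} {x : A} (h : x ∈ xs) :
    x ∈ Ideal.ofList xs :=
  Ideal.subset_span h

lemma map_eq_of_sup_ofList_eq {R S : Type*} [CommRing R] [CommRing S] {π : S →+* R}
    {xs : List S} (hsurj : Function.Surjective π)
    (hker : RingHom.ker π = Ideal.ofList xs) {I : Ideal R} {J : Ideal S}
    (h : J ⊔ Ideal.ofList xs = I.comap π) : J.map π = I := by
  rw [← Ideal.map_comap_of_surjective π hsurj I, ← h, Ideal.map_sup, ← hker,
    (Ideal.map_eq_bot_iff_le_ker π).2 le_rfl, sup_bot_eq]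

/-- `J` is a lift of `I` along `π` on whose quotient `xs` is regular, where `I` is
Cohen-Macaulay. -/
def IsCMLift {R S : Type*} [CommRing R] [CommRing S] [IsLocalRing S] (π : S →+* R) (xs : List S)
    (I : Ideal R) (J : Ideal S) : Prop :=
  (∃ d, DepthTo IsArtinianMod d (I.comap π)) ∧ RegularSeqMod J xs ∧
    J ⊔ Ideal.ofList xs = I.comap π

variable {R S : Type} [CommRing R] [CommRing S] [IsLocalRing S] {π : S →+* R} {xs : List S}

variable [IsNoetherianRing S]

lemma IsCompleteIntersectionIdeal.exists_lift (hsurj : Function.Surjective π)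
    (hker : RingHom.ker π = Ideal.ofList xs) (hm : ∀ x ∈ xs, x ∈ maximalIdeal S)
    (hxs : RegularSeqMod ⊥ xs) {n : ℕ} (hS : DepthTo IsGorensteinArtinianMod n (⊥ : Ideal S))
    {c : Ideal R} (hc : IsCompleteIntersectionIdeal R c) {J : Ideal S} (hcJ : c ≤ J.map π) :
    ∃ c' ≤ J, IsCompleteIntersectionIdeal S c' ∧ RegularSeqMod c' xs ∧
      c' ⊔ Ideal.ofList xs = c.comap π ∧ ∃ e, DepthTo IsGorensteinArtinianMod e (c.comap π) := by
  obtain ⟨hne, α, hα, rfl⟩ := hc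
  obtain ⟨a, rfl, ha⟩ := exists_list_map_eq hsurj fun r hr => hcJ (mem_ofList hr)
  have hker' : (⊥ : Ideal R).comap π = ⊥ ⊔ Ideal.ofList xs := by
    rw [bot_sup_eq, ← hker, RingHom.ker_eq_comap_bot]
  have hreg : RegularSeqMod (⊥ ⊔ Ideal.ofList xs) a := by
    rw [← hker', regularSeqMod_comap π hsurj]
    exact (isRegular_iff_regularSeqMod.1 hα).1
  have hcomap : (Ideal.ofList (a.map π)).comap π = Ideal.ofList xs ⊔ Ideal.ofList a := by
    rw [← bot_sup_eq (Ideal.ofList (a.map π)), comap_sup_ofList π hsurj, hker', bot_sup_eq]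
  have hne' : (Ideal.ofList (a.map π)).comap π ≠ ⊤ := Ideal.comap_ne_top π hne
  obtain ⟨h1, h2⟩ := hxs.append_comm hm hreg
  have hane : Ideal.ofList a ≠ ⊤ := fun h => hne' (by rw [hcomap, h, sup_top_eq])
  obtain ⟨e', he'⟩ := hS.sup_ofList hm hxs
  obtain ⟨e, he⟩ := he'.sup_ofList (fun y hy => le_maximalIdeal hane (mem_ofList hy)) hreg
  refine ⟨Ideal.ofList a, ofList_le ha, ⟨hane, a, isRegular_iff_regularSeqMod.2 ⟨h1, hane⟩, rfl⟩,
    by simpa using h2, by rw [hcomap, sup_comm], e, ?_⟩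
  rwa [hcomap, ← bot_sup_eq (Ideal.ofList xs)]

lemma colon_lift (hm : ∀ x ∈ xs, x ∈ maximalIdeal S) {c I : Ideal R} {c' J : Ideal S}
    (hcJ : c' ≤ J) (hc : RegularSeqMod c' xs) (hcx : c' ⊔ Ideal.ofList xs = c.comap π)
    (hJ : RegularSeqMod J xs) (hJx : J ⊔ Ideal.ofList xs = I.comap π) {e : ℕ}
    (hce : DepthTo IsGorensteinArtinianMod e (c.comap π))
    (hIe : DepthTo IsArtinianMod e (I.comap π)) :
    RegularSeqMod (Submodule.colon c' (J : Set S)) xs ∧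
      Submodule.colon c' (J : Set S) ⊔ Ideal.ofList xs =
        Submodule.colon (c.comap π) (I.comap π : Set S) := by
  have hJc : J ⊔ c' = J := sup_eq_left.2 hcJ
  have hext : HomExtends (c.comap π) J := hce.homExtends <| by
    rw [← hcx, ← sup_assoc, hJc, hJx]
    exact hIe.mono fun _ _ => trivial
  obtain ⟨-, h1, h2⟩ := HomExtends.of_sup_ofList hm hc (by rwa [hJc]) (hcx ▸ hext)
  refine ⟨h1, ?_⟩
  rw [h2, hcx, ← hJx, colon_sup_eq (hcx ▸ le_sup_right)]

lemma IsDirectlyLinked.exists_lift (hsurj : Function.Surjective π)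
    (hker : RingHom.ker π = Ideal.ofList xs) (hm : ∀ x ∈ xs, x ∈ maximalIdeal S)
    (hxs : RegularSeqMod ⊥ xs) {n : ℕ} (hS : DepthTo IsGorensteinArtinianMod n (⊥ : Ideal S))
    {I I' : Ideal R} (h : IsDirectlyLinked R I I') {J : Ideal S} (hJ : IsCMLift π xs I J) :
    ∃ J', IsCMLift π xs I' J' ∧ IsDirectlyLinked S J J' := by
  obtain ⟨hI, hI', c, hc, hcI, hcol1, hcol2⟩ := h
  obtain ⟨⟨d, hd⟩, hJreg, hJx⟩ := hJ
  obtain ⟨c', hc'J, hc', hc'reg, hcx, e, he⟩ := hc.exists_lift hsurj hker hm hxs hS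
    ((hcI.trans inf_le_left).trans (map_eq_of_sup_ofList_eq hsurj hker hJx).ge)
  have hcolon : Submodule.colon (c.comap π) (I.comap π : Set S) = I'.comap π := by
    rw [colon_comap π hsurj, hcol2]
  have hcolon' : Submodule.colon (c.comap π) (I'.comap π : Set S) = I.comap π := by
    rw [colon_comap π hsurj, hcol1]
  have hIe : DepthTo IsArtinianMod e (I.comap π) := by
    refine he.isArtinianMod_of_colon hd (Ideal.comap_mono (hcI.trans inf_le_left))
      (Ideal.comap_ne_top π hI) fun hle => Ideal.comap_ne_top π hI ?_
    rw [hcolon] at hle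
    rw [Ideal.eq_top_iff_one, ← hcolon', mem_colon_iff_mul_mem]
    exact fun s hs => by simpa using hle hs
  have hI'e : DepthTo IsArtinianMod e (I'.comap π) := by
    rw [← hcolon]
    exact he.isArtinianMod_colon hIe (Ideal.comap_mono (hcI.trans inf_le_left))
  obtain ⟨h1, h2⟩ := colon_lift hm hc'J hc'reg hcx hJreg hJx he hIe
  rw [hcolon] at h2
  obtain ⟨h3, h4⟩ := colon_lift hm (le_colon_self c' J) hc'reg hcx h1 h2 he hI'e
  rw [hcolon'] at h4
  have hle : J ≤ Submodule.colon c' (Submodule.colon c' (J : Set S) : Set S) := fun s hs =>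
    mem_colon_iff_mul_mem.2 fun t ht => mul_comm s t ▸ mem_colon_iff_mul_mem.1 ht s hs
  refine ⟨Submodule.colon c' (J : Set S), ⟨⟨e, hI'e⟩, h1, h2⟩, ?_, ?_, c', hc',
    le_inf hc'J (le_colon_self c' J), le_antisymm ?_ hle, rfl⟩
  · rintro rfl
    exact Ideal.comap_ne_top π hI (by rw [← hJx, top_sup_eq])
  · intro htop
    exact Ideal.comap_ne_top π hI' (by rw [← h2, htop, top_sup_eq])
  · exact h3.le_of_le_sup_ofList hm hle (by rw [hJx, ← h4]; exact le_sup_left)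

lemma IsDirectlyLinked.symm {R : Type} [CommRing R] {I J : Ideal R} (h : IsDirectlyLinked R I J) :
    IsDirectlyLinked R J I := by
  obtain ⟨hI, hJ, c, hc, hle, h1, h2⟩ := h
  exact ⟨hJ, hI, c, hc, inf_comm I J ▸ hle, h2, h1⟩

lemma InSameLinkageClass.exists_lift (hsurj : Function.Surjective π)
    (hker : RingHom.ker π = Ideal.ofList xs) (hm : ∀ x ∈ xs, x ∈ maximalIdeal S)
    (hxs : RegularSeqMod ⊥ xs) {n : ℕ} (hS : DepthTo IsGorensteinArtinianMod n (⊥ : Ideal S))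
    {I K : Ideal R} (h : InSameLinkageClass R I K) :
    (∀ J, IsCMLift π xs I J → ∃ L, IsCMLift π xs K L ∧ InSameLinkageClass S J L) ∧
      ∀ J, IsCMLift π xs K J → ∃ L, IsCMLift π xs I L ∧ InSameLinkageClass S J L := by
  induction h with
  | rel I K h =>
    constructor
    · intro J hJ
      obtain ⟨L, hL, hJL⟩ := h.exists_lift hsurj hker hm hxs hS hJ
      exact ⟨L, hL, .rel _ _ hJL⟩
    · intro J hJ
      obtain ⟨L, hL, hJL⟩ := h.symm.exists_lift hsurj hker hm hxs hS hJ
      exact ⟨L, hL, .rel _ _ hJL⟩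
  | refl I => exact ⟨fun J hJ => ⟨J, hJ, .refl _⟩, fun J hJ => ⟨J, hJ, .refl _⟩⟩
  | symm I K _ ih => exact ih.symm
  | trans I K L _ _ ih₁ ih₂ =>
    constructor
    · intro J hJ
      obtain ⟨J₁, hJ₁, h₁⟩ := ih₁.1 J hJ
      obtain ⟨J₂, hJ₂, h₂⟩ := ih₂.1 J₁ hJ₁
      exact ⟨J₂, hJ₂, .trans _ _ _ h₁ h₂⟩
    · intro J hJ
      obtain ⟨J₁, hJ₁, h₁⟩ := ih₂.2 J hJ
      obtain ⟨J₂, hJ₂, h₂⟩ := ih₁.2 J₁ hJ₁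
      exact ⟨J₂, hJ₂, .trans _ _ _ h₁ h₂⟩

lemma Licci.of_isCMLift (hsurj : Function.Surjective π)
    (hker : RingHom.ker π = Ideal.ofList xs) (hm : ∀ x ∈ xs, x ∈ maximalIdeal S)
    (hxs : RegularSeqMod ⊥ xs) {n : ℕ} (hS : DepthTo IsGorensteinArtinianMod n (⊥ : Ideal S))
    {I : Ideal R} {J : Ideal S} (hJ : IsCMLift π xs I J) (h : Licci R I) : Licci S J := by
  obtain ⟨K, hIK, hK⟩ := h
  obtain ⟨L, ⟨-, hLreg, hLx⟩, hJL⟩ := (hIK.exists_lift hsurj hker hm hxs hS).1 J hJ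
  obtain ⟨c', hc'L, hc', -, hcx, -⟩ := hK.exists_lift hsurj hker hm hxs hS
    (map_eq_of_sup_ofList_eq hsurj hker hLx).ge
  have : L = c' := le_antisymm
    (hLreg.le_of_le_sup_ofList hm hc'L (by rw [hcx, ← hLx]; exact le_sup_left)) hc'L
  exact ⟨L, hJL, this ▸ hc'⟩

lemma intLink_le_map_of_isCMLift (hsurj : Function.Surjective π)
    (hker : RingHom.ker π = Ideal.ofList xs) (hm : ∀ x ∈ xs, x ∈ maximalIdeal S)
    (hxs : RegularSeqMod ⊥ xs) {n : ℕ} (hS : DepthTo IsGorensteinArtinianMod n (⊥ : Ideal S))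
    {I : Ideal R} {J : Ideal S} (hJ : IsCMLift π xs I J) :
    intLink R I ≤ (intLink S J).map π := by
  by_cases hlS : Licci S J
  · rw [intLink, intLink, if_pos hlS, Ideal.map_top]
    exact le_top
  · rw [intLink, intLink, if_neg hlS,
      if_neg fun h => hlS (h.of_isCMLift hsurj hker hm hxs hS hJ)]
    refine sSup_le fun K hK => ?_
    obtain ⟨L, ⟨-, -, hLx⟩, hJL⟩ := (InSameLinkageClass.exists_lift hsurj hker hm hxs hS hK).1 J hJ
    rw [← map_eq_of_sup_ofList_eq hsurj hker hLx]
    exact Ideal.map_mono (le_sSup hJL)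

end Deformation

section CohenMacaulay

lemma IsCMLocalRing.exists_isRegular {B : Type} [CommRing B] [IsLocalRing B] [IsNoetherianRing B]
    (h : IsCMLocalRing B) :
    ∃ ys : List B, (∀ y ∈ ys, y ∈ maximalIdeal B) ∧ Sequence.IsRegular B ys ∧
      IsArtinianMod (Ideal.ofList ys) := by
  obtain ⟨d, hd⟩ : ∃ d : ℕ, ringKrullDim B = d := ⟨_, h⟩
  obtain ⟨ys, hlen, hys, hreg⟩ : gradeOf B (maximalIdeal B) ∈
      {n : ℕ | ∃ rs : List B, rs.length = n ∧ (∀ r ∈ rs, r ∈ maximalIdeal B) ∧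
        Sequence.IsRegular B rs} := by
    refine Nat.sSup_mem ⟨0, [], rfl, by simp, ?_⟩ ⟨d, ?_⟩
    · exact isRegular_iff_regularSeqMod.2 ⟨trivial, by simp⟩
    · rintro n ⟨rs, rfl, -, hrs⟩
      have : Nontrivial (B ⧸ Ideal.ofList rs) :=
        Ideal.Quotient.nontrivial_iff.2 (isRegular_iff_regularSeqMod.1 hrs).2
      have h0 : 0 ≤ ringKrullDim (B ⧸ Ideal.ofList rs) := ringKrullDim_nonneg_of_nontrivial
      have : (rs.length : WithBot ℕ∞) ≤ d := by
        rw [← hd, ← ringKrullDim_add_length_eq_ringKrullDim_of_isRegular rs hrs]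
        exact le_add_of_nonneg_left h0
      exact_mod_cast this
  refine ⟨ys, hys, hreg, isArtinianMod_iff_ringKrullDim_le_zero.2 ?_⟩
  have h1 := ringKrullDim_add_length_eq_ringKrullDim_of_isRegular ys hreg
  rw [hlen, h] at h1
  refine le_of_eq ((ENat.WithBot.add_natCast_cancel (c := gradeOf B (maximalIdeal B))).1 ?_)
  rw [zero_add]
  exact h1

lemma IsCMIdeal.exists_depthTo {R S : Type} [CommRing R] [IsNoetherianRing R] [CommRing S]
    [IsLocalRing S] {π : S →+* R} (hsurj : Function.Surjective π) {I : Ideal R}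
    (h : IsCMIdeal R I) : ∃ d, DepthTo IsArtinianMod d (I.comap π) := by
  obtain ⟨_, hCM⟩ := h
  obtain ⟨ys, hys, hreg, hart⟩ := hCM.exists_isRegular
  let φ : S →+* R ⧸ I := (Ideal.Quotient.mk I).comp π
  have hφ : Function.Surjective φ := Ideal.Quotient.mk_surjective.comp hsurj
  obtain ⟨zs, rfl⟩ := hφ.list_map ys
  have hm : (maximalIdeal (R ⧸ I)).comap φ = maximalIdeal S :=
    eq_maximalIdeal (Ideal.comap_isMaximal_of_surjective φ hφ)
  have hbot : (⊥ : Ideal (R ⧸ I)).comap φ = I.comap π := by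
    rw [← Ideal.comap_comap, ← RingHom.ker_eq_comap_bot, Ideal.mk_ker]
  refine ⟨_, .of_regularSeqMod (xs := zs) (fun z hz => ?_) ?_ ?_⟩
  · rw [← hm]
    exact hys _ (List.mem_map_of_mem hz)
  · rw [← hbot, regularSeqMod_comap φ hφ]
    exact (isRegular_iff_regularSeqMod.1 hreg).1
  · rw [← hbot, ← comap_sup_ofList φ hφ, bot_sup_eq, IsArtinianMod, ← hm, ← Ideal.comap_radical]
    exact Ideal.comap_mono hart

lemma IsGorensteinLocalRing.exists_depthTo {S : Type} [CommRing S] [IsLocalRing S]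
    [IsNoetherianRing S] (h : IsGorensteinLocalRing S) :
    ∃ n, DepthTo IsGorensteinArtinianMod n (⊥ : Ideal S) := by
  obtain ⟨-, rs, hreg, hrad, hirr⟩ := h
  obtain ⟨hreg, hne⟩ := isRegular_iff_regularSeqMod.1 hreg
  refine ⟨_, .of_regularSeqMod (fun r hr => le_maximalIdeal hne (mem_ofList hr)) hreg ?_⟩
  rw [bot_sup_eq]
  exact ⟨hrad.ge, simpleSocle_of_infIrred hrad.ge hirr⟩

end CohenMacaulay

/-- Lemma 2.12. Let `I` be a Cohen-Macaulay ideal of positive grade in a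
Noetherian local Gorenstein ring `R` with infinite residue field, and let `(S,J)` be a
deformation of `(R,I)`, where `S` is a local Gorenstein ring with infinite residue field:
there are a surjection `π : S → R` whose kernel is generated by a sequence `xs` regular on
`S` and on `S/J`, with `π(J) = I`.  Then `∫_R I ⊆ (∫_S J)·R`. -/
theorem statement9 (R : Type) [CommRing R] [IsLocalRing R] [IsNoetherianRing R]
    (hGor : IsGorensteinLocalRing R) (hres : Infinite (IsLocalRing.ResidueField R))
    (S : Type) [CommRing S] [IsLocalRing S] [IsNoetherianRing S]
    (hGorS : IsGorensteinLocalRing S) (hresS : Infinite (IsLocalRing.ResidueField S))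
    (I : Ideal R) (hCM : IsCMIdeal R I) (hgrade : ∃ r ∈ I, r ∈ nonZeroDivisors R)
    (J : Ideal S) (π : S →+* R) (xs : List S)
    (hsurj : Function.Surjective π)
    (hker : RingHom.ker π = Ideal.ofList xs)
    (hreg : RingTheory.Sequence.IsRegular S xs)
    (hregJ : RingTheory.Sequence.IsRegular (S ⧸ J) xs)
    (hJI : J.map π = I) :
    intLink R I ≤ (intLink S J).map π := by
  obtain ⟨n, hS⟩ := hGorS.exists_depthTo
  obtain ⟨hxs, hne⟩ := isRegular_iff_regularSeqMod.1 hreg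
  refine intLink_le_map_of_isCMLift hsurj hker
    (fun x hx => le_maximalIdeal hne (mem_ofList hx)) hxs hS
    ⟨hCM.exists_depthTo hsurj, regularSeqMod_iff_isWeaklyRegular.2 hregJ.toIsWeaklyRegular, ?_⟩
  rw [← hJI, Ideal.comap_map_of_surjective π hsurj, ← RingHom.ker_eq_comap_bot, hker]
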